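/- arXiv:2303.15898 — 2 statements merged into one kernel-verified Lean document; each statement's English description precedes it below -/
import Mathlib

section
/- Define f : [0,1] → ℝ by f(q) = q for q ≤ 0.3, f(q) = 1.2q − 0.06 for 0.3 < q ≤ 0.5, f(q) = 0.8q + 0.14 for 0.5 < q ≤ 0.7, and f(q) = q for q > 0.7, and define g : [0,1] → [0,1] by g(q) = q(1 − q) + (1 − q)(1 − f(q)) (the next-period probability of state 0 in the nonlinear chain on {0,1} with row 0 equal to (μ({1}), μ({0})) and row 1 equal to (1 − f(μ({0})), f(μ({0})))). Then: (a) g(0.7) = 0.3 and g(0.3) = 0.7, so the orbit (gⁿ(0.7)) alternates between 0.7 and 0.3 and its Cesàro averages (1/T)·Σ_{t=1}^{T} gᵗ(0.7) converge to 1/2; (b) g(1/2) ≠ 1/2, i.e., the distribution (1/2, 1/2) is not invariant. Hence the Cesàro averages of the marginal distributions converge to a limit that is not an invariant distribution of the chain. -/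
open Filter Topology Finset

/-- Closed form of the orbit of a point of a two-cycle. -/
theorem iterate_eq_of_two_cycle {g : ℝ → ℝ} {a b : ℝ} (hab : g a = b) (hba : g b = a) (n : ℕ) :
    g^[n] a = (a + b) / 2 + (a - b) / 2 * (-1) ^ n := by
  have h2 : g^[2] a = a := by simp [hab, hba]
  rcases Nat.even_or_odd' n with ⟨k, rfl | rfl⟩
  · rw [Function.iterate_mul, Function.iterate_fixed h2, (even_two_mul k).neg_one_pow]
    ring
  · rw [Function.iterate_succ_apply', Function.iterate_mul, Function.iterate_fixed h2, hab,
      (odd_two_mul_add_one k).neg_one_pow]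
    ring

theorem sum_iterate_of_two_cycle {g : ℝ → ℝ} {a b : ℝ} (hab : g a = b) (hba : g b = a) (T : ℕ) :
    ∑ t ∈ Icc 1 T, g^[t] a = (a + b) / 2 * T + (b - a) / 4 * (1 - (-1) ^ T) := by
  induction T with
  | zero => simp
  | succ T ih =>
    rw [sum_Icc_succ_top (by lia), ih, iterate_eq_of_two_cycle hab hba]
    push_cast
    ring

/-- The Cesàro averages along a two-cycle converge to its midpoint. -/
theorem tendsto_cesaro_of_two_cycle {g : ℝ → ℝ} {a b : ℝ} (hab : g a = b) (hba : g b = a) :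
    Tendsto (fun T : ℕ => (∑ t ∈ Icc 1 T, g^[t] a) / (T : ℝ)) atTop (𝓝 ((a + b) / 2)) := by
  have hosc : Tendsto (fun T : ℕ => (b - a) / 4 * (1 - (-1 : ℝ) ^ T) / T) atTop (𝓝 0) := by
    refine squeeze_zero_norm (fun T => ?_)
      (tendsto_const_div_atTop_nhds_zero_nat (|(b - a) / 4| * 2))
    rw [norm_div, norm_mul, Real.norm_eq_abs, Real.norm_natCast]
    gcongr
    rcases neg_one_pow_eq_or ℝ T with h | h <;> norm_num [h]
  have hlim := hosc.const_add ((a + b) / 2)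
  rw [add_zero] at hlim
  refine hlim.congr' ?_
  filter_upwards [eventually_gt_atTop 0] with T hT
  have hT' : (T : ℝ) ≠ 0 := by positivity
  rw [sum_iterate_of_two_cycle hab hba]
  field_simp

/-- **Example (Cesàro averages do not converge to an invariant distribution)**:
With `f` the piecewise map `f(q) = q` for `q ≤ 0.3`, `f(q) = 1.2q − 0.06` for
`0.3 < q ≤ 0.5`, `f(q) = 0.8q + 0.14` for `0.5 < q ≤ 0.7`, `f(q) = q` for
`q > 0.7`, and `g(q) = q(1 − q) + (1 − q)(1 − f(q))` the next-period probability
of state `0`: (a) `g(0.7) = 0.3` and `g(0.3) = 0.7`, the orbit of `0.7` under `g`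
alternates between `0.7` and `0.3`, and the Cesàro averages
`(1/T)·Σ_{t=1}^{T} gᵗ(0.7)` converge to `1/2`; (b) `g(1/2) ≠ 1/2`, i.e. the limit
`(1/2, 1/2)` is not an invariant distribution. -/
theorem cesaro_averages_do_not_converge_to_invariant
    (f g : ℝ → ℝ)
    (hf : ∀ q : ℝ, f q =
      if q ≤ 0.3 then q
      else if q ≤ 0.5 then 1.2 * q - 0.06
      else if q ≤ 0.7 then 0.8 * q + 0.14
      else q)
    (hg : ∀ q : ℝ, g q = q * (1 - q) + (1 - q) * (1 - f q)) :
    g 0.7 = 0.3 ∧ g 0.3 = 0.7 ∧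
    (∀ n : ℕ, Even n → g^[n] 0.7 = 0.7) ∧
    (∀ n : ℕ, Odd n → g^[n] 0.7 = 0.3) ∧
    Tendsto (fun T : ℕ => (∑ t ∈ Icc 1 T, g^[t] 0.7) / (T : ℝ)) atTop (𝓝 (1 / 2)) ∧
    g (1 / 2) ≠ 1 / 2 := by
  have h7 : g 0.7 = 0.3 := by rw [hg, hf]; norm_num
  have h3 : g 0.3 = 0.7 := by rw [hg, hf]; norm_num
  refine ⟨h7, h3, fun n hn => ?_, fun n hn => ?_, ?_, ?_⟩
  · rw [iterate_eq_of_two_cycle h7 h3, hn.neg_one_pow]; norm_num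
  · rw [iterate_eq_of_two_cycle h7 h3, hn.neg_one_pow]; norm_num
  · convert tendsto_cesaro_of_two_cycle h7 h3 using 2
    norm_num
  · rw [hg, hf]; norm_num
end

section
/- Let S = {0, 1, …, N} with its natural order and identify probability measures on S with vectors μ ∈ Δ_{N+1}. For μ, λ define σ and ι by σ({t,…,N}) = max(μ({t,…,N}), λ({t,…,N})) and ι({t,…,N}) = min(μ({t,…,N}), λ({t,…,N})) for all t = 0,…,N. Then σ and ι are well-defined probability measures on S, and with respect to first-order stochastic dominance ⪰_SD, σ is the least upper bound of {μ, λ} and ι is the greatest lower bound of {μ, λ}; consequently (P(S), ⪰_SD) is a lattice. -/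
open Finset

/-- The tail `μ({t, …, N})` of a probability vector `μ` on `{0, …, N}`. -/
def tailSum {N : ℕ} (μ : Fin (N + 1) → ℝ) (t : Fin (N + 1)) : ℝ :=
  ∑ j ∈ univ.filter (fun j => t ≤ j), μ j

/-- First-order stochastic dominance on probability vectors on `{0, …, N}`:
`SDge μ ν` means `μ ⪰_SD ν`, i.e. every tail of `μ` dominates that of `ν`. -/
def SDge {N : ℕ} (μ ν : Fin (N + 1) → ℝ) : Prop :=
  ∀ t : Fin (N + 1), tailSum ν t ≤ tailSum μ t

/-- The tail of `μ` indexed by a natural number, so that the empty tail is included. -/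
def natTail {N : ℕ} (μ : Fin (N + 1) → ℝ) (n : ℕ) : ℝ :=
  ∑ j ∈ univ.filter (fun j : Fin (N + 1) => n ≤ (j : ℕ)), μ j

lemma tailSum_eq_natTail {N : ℕ} (μ : Fin (N + 1) → ℝ) (t : Fin (N + 1)) :
    tailSum μ t = natTail μ t := rfl

lemma natTail_zero {N : ℕ} (μ : Fin (N + 1) → ℝ) : natTail μ 0 = ∑ j, μ j := by
  simp [natTail]

lemma natTail_last {N : ℕ} (μ : Fin (N + 1) → ℝ) : natTail μ (N + 1) = 0 := by
  refine Finset.sum_eq_zero fun j hj => ?_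
  have := (Finset.mem_filter.1 hj).2
  omega

lemma natTail_eq_add {N : ℕ} (μ : Fin (N + 1) → ℝ) (i : Fin (N + 1)) :
    natTail μ i = μ i + natTail μ (i + 1) := by
  unfold natTail
  rw [← Finset.sum_insert (by simp)]
  congr 1
  ext j
  simp only [Finset.mem_filter, Finset.mem_univ, true_and, Finset.mem_insert, Fin.ext_iff]
  omega

lemma natTail_succ_le {N : ℕ} {μ : Fin (N + 1) → ℝ} (hμ : ∀ i, 0 ≤ μ i) (i : Fin (N + 1)) :
    natTail μ (i + 1) ≤ natTail μ i := by
  linarith [natTail_eq_add μ i, hμ i]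

lemma tailSum_injective {N : ℕ} {μ ν : Fin (N + 1) → ℝ} (h : ∀ t, tailSum μ t = tailSum ν t) :
    μ = ν := by
  have key : ∀ n ≤ N + 1, natTail μ n = natTail ν n := fun n hn => by
    rcases hn.lt_or_eq with hn | rfl
    · exact h ⟨n, hn⟩
    · rw [natTail_last, natTail_last]
  funext i
  linarith [natTail_eq_add μ i, natTail_eq_add ν i, key i (by omega), key (i + 1) (by omega)]

/-- A nonincreasing sequence from `1` to `0` is the sequence of tails of a probability vector. -/
lemma exists_stdSimplex_tailSum_eq {N : ℕ} (T : ℕ → ℝ) (h0 : T 0 = 1) (hN : T (N + 1) = 0)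
    (hT : ∀ i : Fin (N + 1), T (i + 1) ≤ T i) :
    ∃ σ ∈ stdSimplex ℝ (Fin (N + 1)), ∀ t : Fin (N + 1), tailSum σ t = T t := by
  let σ : Fin (N + 1) → ℝ := fun i => T i - T (i + 1)
  have key : ∀ n ≤ N + 1, natTail σ n = T n := fun n hn => by
    induction hn using Nat.decreasingInduction with
    | self => rw [natTail_last, hN]
    | of_succ k hk ih =>
      have h := natTail_eq_add σ ⟨k, hk⟩
      simp only [ih, σ] at h ⊢
      linarith
  refine ⟨σ, ⟨fun i => sub_nonneg.2 (hT i), ?_⟩, fun t => key t (by omega)⟩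
  rw [← natTail_zero, key 0 (Nat.zero_le _), h0]

/-- **`(P(S), ⪰_SD)` is a complete lattice on a finite totally ordered state space**:
for probability vectors `μ, ν` on `S = {0, …, N}`, the prescriptions
`σ({t,…,N}) = max(μ({t,…,N}), ν({t,…,N}))` and `ι({t,…,N}) = min(μ({t,…,N}), ν({t,…,N}))`
define (unique) probability measures `σ` and `ι` on `S`, and with respect to
first-order stochastic dominance `σ` is the least upper bound and `ι` the greatest
lower bound of `{μ, ν}`; consequently `(P(S), ⪰_SD)` is a lattice. -/
theorem stochastic_dominance_lattice {N : ℕ}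
    (μ ν : Fin (N + 1) → ℝ)
    (hμ : μ ∈ stdSimplex ℝ (Fin (N + 1))) (hν : ν ∈ stdSimplex ℝ (Fin (N + 1))) :
    (∃! σ : Fin (N + 1) → ℝ, σ ∈ stdSimplex ℝ (Fin (N + 1)) ∧
      (∀ t, tailSum σ t = max (tailSum μ t) (tailSum ν t)) ∧
      SDge σ μ ∧ SDge σ ν ∧
      ∀ ρ ∈ stdSimplex ℝ (Fin (N + 1)), SDge ρ μ → SDge ρ ν → SDge ρ σ) ∧
    (∃! ι : Fin (N + 1) → ℝ, ι ∈ stdSimplex ℝ (Fin (N + 1)) ∧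
      (∀ t, tailSum ι t = min (tailSum μ t) (tailSum ν t)) ∧
      SDge μ ι ∧ SDge ν ι ∧
      ∀ ρ ∈ stdSimplex ℝ (Fin (N + 1)), SDge μ ρ → SDge ν ρ → SDge ι ρ) := by
  constructor
  · obtain ⟨σ, hσ, h⟩ := exists_stdSimplex_tailSum_eq (N := N)
      (fun n => max (natTail μ n) (natTail ν n))
      (by simp [natTail_zero, hμ.2, hν.2]) (by simp [natTail_last])
      (fun i => max_le_max (natTail_succ_le hμ.1 i) (natTail_succ_le hν.1 i))
    refine ⟨σ, ⟨hσ, h, fun t => (le_max_left _ _).trans (h t).ge,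
      fun t => (le_max_right _ _).trans (h t).ge,
      fun ρ _ h₁ h₂ t => (h t).le.trans (max_le (h₁ t) (h₂ t))⟩, ?_⟩
    rintro τ ⟨-, hτ, -⟩
    exact tailSum_injective fun t => (hτ t).trans (h t).symm
  · obtain ⟨ι, hι, h⟩ := exists_stdSimplex_tailSum_eq (N := N)
      (fun n => min (natTail μ n) (natTail ν n))
      (by simp [natTail_zero, hμ.2, hν.2]) (by simp [natTail_last])
      (fun i => min_le_min (natTail_succ_le hμ.1 i) (natTail_succ_le hν.1 i))
    refine ⟨ι, ⟨hι, h, fun t => (h t).le.trans (min_le_left _ _),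
      fun t => (h t).le.trans (min_le_right _ _),
      fun ρ _ h₁ h₂ t => (le_min (h₁ t) (h₂ t)).trans (h t).ge⟩, ?_⟩
    rintro τ ⟨-, hτ, -⟩
    exact tailSum_injective fun t => (hτ t).trans (h t).symm
end
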